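/- arXiv:2603.19205 — 2 statements merged into one kernel-verified Lean document; each statement's English description precedes it below -/
import Mathlib

section
/- Let G be a finite nonabelian group of order n. Consider the action of G × S₃ × G on G³ in which the first factor acts by simultaneous left multiplication on all three coordinates, S₃ permutes the coordinates, and the last factor acts by simultaneous right multiplication on all three coordinates. Then the number h'(G) of orbits of this action satisfies 48·h'(G) ≤ 5n² + 40n. -/
/-- For a (possibly nonabelian) group `G`, a hexagon is an orbit of `G³` under the action
of `G × S₃ × G`: simultaneous left multiplication, permutation of coordinates, and
simultaneous right multiplication.  `skewHexRel v w` says `w` lies in the orbit of `v`. -/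
def skewHexRel {G : Type*} [Group G] (v w : G × G × G) : Prop :=
  ∃ g h : G,
    w = (g * v.1 * h, g * v.2.1 * h, g * v.2.2 * h) ∨
    w = (g * v.1 * h, g * v.2.2 * h, g * v.2.1 * h) ∨
    w = (g * v.2.1 * h, g * v.1 * h, g * v.2.2 * h) ∨
    w = (g * v.2.1 * h, g * v.2.2 * h, g * v.1 * h) ∨
    w = (g * v.2.2 * h, g * v.1 * h, g * v.2.1 * h) ∨
    w = (g * v.2.2 * h, g * v.2.1 * h, g * v.1 * h)

/-- A subset of `G³` is a (skew) hexagon if it is the orbit of some triple under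
the `G × S₃ × G` action. -/
def IsSkewHexagon {G : Type*} [Group G] (H : Set (G × G × G)) : Prop :=
  ∃ v : G × G × G, H = {w | skewHexRel v w}

/-- The number of hexagons of a (possibly nonabelian) group `G`. -/
noncomputable def numSkewHexagons (G : Type*) [Group G] : ℕ :=
  Nat.card {H : Set (G × G × G) // IsSkewHexagon H}

/-- The action of `S₃ × (G × G)` on triples by permutation of coordinates and simultaneous
left and right multiplication. -/
@[reducible] def tripleAction (G : Type*) [Group G] :
    MulAction (Equiv.Perm (Fin 3) × (G × G)) (Fin 3 → G) where
  smul a v := fun i => a.2.1 * v (a.1⁻¹ i) * a.2.2⁻¹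
  one_smul v := by funext i; change 1 * v _ * 1⁻¹ = _; simp
  mul_smul a b v := by
    funext i
    change (a.2.1 * b.2.1) * v ((a.1 * b.1)⁻¹ i) * (a.2.2 * b.2.2)⁻¹ =
      a.2.1 * (b.2.1 * v (b.1⁻¹ (a.1⁻¹ i)) * b.2.2⁻¹) * a.2.2⁻¹
    simp [mul_assoc]

lemma exists_perm_fin_three_triple {α : Type*} (a b c : α) (P : (Fin 3 → α) → Prop) :
    (∃ σ : Equiv.Perm (Fin 3), P (fun i => ![a, b, c] (σ i))) ↔
      P ![a, b, c] ∨ P ![a, c, b] ∨ P ![b, a, c] ∨ P ![b, c, a] ∨ P ![c, a, b] ∨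
        P ![c, b, a] := by
  have perm_cases : ∀ σ : Equiv.Perm (Fin 3),
      (σ 0 = 0 ∧ σ 1 = 1 ∧ σ 2 = 2) ∨ (σ 0 = 0 ∧ σ 1 = 2 ∧ σ 2 = 1) ∨
      (σ 0 = 1 ∧ σ 1 = 0 ∧ σ 2 = 2) ∨ (σ 0 = 1 ∧ σ 1 = 2 ∧ σ 2 = 0) ∨
      (σ 0 = 2 ∧ σ 1 = 0 ∧ σ 2 = 1) ∨ (σ 0 = 2 ∧ σ 1 = 1 ∧ σ 2 = 0) := by decide
  have exists_perm : ∀ i j k : Fin 3, i ≠ j → i ≠ k → j ≠ k →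
      ∃ σ : Equiv.Perm (Fin 3), σ 0 = i ∧ σ 1 = j ∧ σ 2 = k := by decide
  have triple_eq : ∀ (σ : Equiv.Perm (Fin 3)) (i j k : Fin 3), σ 0 = i ∧ σ 1 = j ∧ σ 2 = k →
      (fun l => ![a, b, c] (σ l)) = ![![a, b, c] i, ![a, b, c] j, ![a, b, c] k] := by
    rintro σ i j k ⟨rfl, rfl, rfl⟩
    funext l
    fin_cases l <;> rfl
  have attained : ∀ i j k : Fin 3, i ≠ j → i ≠ k → j ≠ k →
      P ![![a, b, c] i, ![a, b, c] j, ![a, b, c] k] →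
      ∃ σ : Equiv.Perm (Fin 3), P (fun i => ![a, b, c] (σ i)) := by
    intro i j k hij hik hjk hP
    obtain ⟨σ, hσ⟩ := exists_perm i j k hij hik hjk
    exact ⟨σ, by rwa [triple_eq σ i j k hσ]⟩
  constructor
  · rintro ⟨σ, hP⟩
    rcases perm_cases σ with h | h | h | h | h | h <;> rw [triple_eq σ _ _ _ h] at hP
    · exact .inl hP
    · exact .inr (.inl hP)
    · exact .inr (.inr (.inl hP))
    · exact .inr (.inr (.inr (.inl hP)))
    · exact .inr (.inr (.inr (.inr (.inl hP))))
    · exact .inr (.inr (.inr (.inr (.inr hP))))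
  · rintro (h | h | h | h | h | h)
    · exact attained 0 1 2 (by decide) (by decide) (by decide) h
    · exact attained 0 2 1 (by decide) (by decide) (by decide) h
    · exact attained 1 0 2 (by decide) (by decide) (by decide) h
    · exact attained 1 2 0 (by decide) (by decide) (by decide) h
    · exact attained 2 0 1 (by decide) (by decide) (by decide) h
    · exact attained 2 1 0 (by decide) (by decide) (by decide) h

lemma skewHexRel_iff_mem_orbit {G : Type*} [Group G] (v w : G × G × G) :
    letI := tripleAction G
    skewHexRel v w ↔ ![w.1, w.2.1, w.2.2] ∈
      MulAction.orbit (Equiv.Perm (Fin 3) × (G × G)) ![v.1, v.2.1, v.2.2] := by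
  let _ := tripleAction G
  obtain ⟨a, b, c⟩ := v
  obtain ⟨x, y, z⟩ := w
  have key (g h : G) := exists_perm_fin_three_triple a b c
    (fun u => (x, y, z) = (g * u 0 * h, g * u 1 * h, g * u 2 * h))
  constructor
  · rintro ⟨g, h, H⟩
    obtain ⟨σ, hσ⟩ := (key g h).2 H
    simp only [Prod.mk.injEq] at hσ
    refine ⟨(σ⁻¹, g, h⁻¹), ?_⟩
    funext i
    change g * ![a, b, c] (σ⁻¹⁻¹ i) * h⁻¹⁻¹ = ![x, y, z] i
    rw [inv_inv, inv_inv]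
    fin_cases i
    · exact hσ.1.symm
    · exact hσ.2.1.symm
    · exact hσ.2.2.symm
  · rintro ⟨⟨σ, g, h⟩, H⟩
    have H' : ∀ i, g * ![a, b, c] (σ⁻¹ i) * h⁻¹ = ![x, y, z] i := congrFun H
    exact ⟨g, h⁻¹, (key g h⁻¹).1 ⟨σ⁻¹, Prod.ext (H' 0).symm
      (Prod.ext (H' 1).symm (H' 2).symm)⟩⟩

lemma numSkewHexagons_le_card_orbits (G : Type*) [Group G] [Finite G] :
    letI := tripleAction G
    numSkewHexagons G ≤
      Nat.card (MulAction.orbitRel.Quotient (Equiv.Perm (Fin 3) × (G × G)) (Fin 3 → G)) := by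
  let _ := tripleAction G
  let toTriple : G × G × G → Fin 3 → G := fun v => ![v.1, v.2.1, v.2.2]
  choose rep hrep using fun H : {H : Set (G × G × G) // IsSkewHexagon H} => H.2
  refine Nat.card_le_card_of_injective (fun H => Quotient.mk'' (toTriple (rep H))) ?_
  intro H K hHK
  have h := MulAction.orbit_eq_iff.2 (Quotient.exact hHK)
  apply Subtype.ext
  rw [hrep H, hrep K]
  ext w
  exact (skewHexRel_iff_mem_orbit _ w).trans
    ((iff_of_eq (congrArg (toTriple w ∈ ·) h)).trans (skewHexRel_iff_mem_orbit _ w).symm)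

/-- Triples fixed by a given coordinate permutation combined with two-sided multiplication,
together with the two multipliers. -/
abbrev FixedTriples (G : Type*) [Group G] (τ : Equiv.Perm (Fin 3)) : Type _ :=
  {p : (G × G) × (Fin 3 → G) // ∀ i, p.1.1 * p.2 (τ i) * p.1.2⁻¹ = p.2 i}

lemma card_orbits_mul_eq_sum_card_fixedTriples (G : Type*) [Group G] [Fintype G] :
    letI := tripleAction G
    Nat.card (MulAction.orbitRel.Quotient (Equiv.Perm (Fin 3) × (G × G)) (Fin 3 → G)) *
      (6 * Fintype.card G ^ 2) =
      ∑ σ : Equiv.Perm (Fin 3), Nat.card (FixedTriples G σ⁻¹) := by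
  let _ := tripleAction G
  have e : (Σ a : Equiv.Perm (Fin 3) × (G × G), MulAction.fixedBy (Fin 3 → G) a) ≃
      Σ σ : Equiv.Perm (Fin 3), FixedTriples G σ⁻¹ :=
    { toFun := fun x => ⟨x.1.1, ⟨(x.1.2, x.2.1), fun i => congrFun x.2.2 i⟩⟩
      invFun := fun y => ⟨(y.1, y.2.1.1), ⟨y.2.1.2, funext y.2.2⟩⟩
      left_inv := fun _ => rfl
      right_inv := fun _ => rfl }
  have h := Nat.card_congr
    ((MulAction.sigmaFixedByEquivOrbitsProdGroup (Equiv.Perm (Fin 3) × (G × G))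
      (Fin 3 → G)).symm.trans e)
  rw [Nat.card_prod, Nat.card_sigma] at h
  rw [← h]
  simp [Nat.card_eq_fintype_card, Fintype.card_perm, Nat.factorial, sq]

lemma card_fixedTriples_le_of_ne_one (G : Type*) [Group G] [Fintype G]
    {τ : Equiv.Perm (Fin 3)} (hτ : τ ≠ 1) :
    Nat.card (FixedTriples G τ) ≤ Fintype.card G ^ 3 := by
  have cycle_type : ∀ τ : Equiv.Perm (Fin 3), τ ≠ 1 →
      ∃ a b c : Fin 3, (∀ i, i = a ∨ i = b ∨ i = c) ∧
        ((τ a = b ∧ τ b = a ∧ τ c = c) ∨ (τ a = b ∧ τ b = c ∧ τ c = a)) := by decide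
  have hcard : Fintype.card G ^ 3 = Nat.card (G × G × G) := by
    simp [Nat.card_eq_fintype_card]; ring
  rw [hcard]
  obtain ⟨a, b, c, hcover, ⟨ha, hb, hc⟩ | ⟨ha, hb, hc⟩⟩ := cycle_type τ hτ
  · refine Nat.card_le_card_of_injective (fun p => (p.1.1.2, p.1.2 a, p.1.2 c)) ?_
    rintro ⟨⟨⟨g, h⟩, v⟩, hv⟩ ⟨⟨⟨g', h'⟩, v'⟩, hv'⟩ heq
    simp only [Prod.mk.injEq] at heq hv hv'
    obtain ⟨rfl, hva, hvc⟩ := heq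
    have hg : g = g' := by
      have h₁ := hv c
      have h₂ := hv' c
      rw [hc] at h₁ h₂
      rw [← hvc] at h₂
      exact mul_right_cancel (mul_right_cancel (h₁.trans h₂.symm))
    subst hg
    have hvb : v b = v' b := by rw [← hv b, ← hv' b, hb, hva]
    congr 2
    funext i
    rcases hcover i with rfl | rfl | rfl <;> assumption
  · refine Nat.card_le_card_of_injective (fun p => (p.1.1.1, p.1.1.2, p.1.2 a)) ?_
    rintro ⟨⟨⟨g, h⟩, v⟩, hv⟩ ⟨⟨⟨g', h'⟩, v'⟩, hv'⟩ heq
    simp only [Prod.mk.injEq] at heq hv hv'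
    obtain ⟨rfl, rfl, hva⟩ := heq
    have hvc : v c = v' c := by rw [← hv c, ← hv' c, hc, hva]
    have hvb : v b = v' b := by rw [← hv b, ← hv' b, hb, hvc]
    congr 2
    funext i
    rcases hcover i with rfl | rfl | rfl <;> assumption

lemma card_fixedTriples_one_le (G : Type*) [Group G] [Fintype G] :
    Nat.card (FixedTriples G 1) ≤
      Fintype.card G ^ 2 * Nat.card {p : G × G // Commute p.1 p.2} := by
  have hcard : Fintype.card G ^ 2 * Nat.card {p : G × G // Commute p.1 p.2} =
      Nat.card ((G × G) × {p : G × G // Commute p.1 p.2}) := by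
    simp [Nat.card_prod, Nat.card_eq_fintype_card, sq]
  rw [hcard]
  have fixed (p : FixedTriples G 1) (i : Fin 3) : p.1.1.1 * p.1.2 i = p.1.2 i * p.1.1.2 :=
    mul_inv_eq_iff_eq_mul.1 (p.2 i)
  refine Nat.card_le_card_of_injective
    (fun p => ((p.1.2 0, p.1.2 2), ⟨(p.1.1.2, (p.1.2 0)⁻¹ * p.1.2 1), ?_⟩)) ?_
  · have h₀ := fixed p 0
    have h₁ := fixed p 1
    change p.1.1.2 * ((p.1.2 0)⁻¹ * p.1.2 1) = (p.1.2 0)⁻¹ * p.1.2 1 * p.1.1.2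
    rw [mul_assoc, ← h₁, eq_mul_inv_of_mul_eq h₀]
    group
  · intro p q heq
    have fp := fixed p 0
    have fq := fixed q 0
    obtain ⟨⟨⟨g, h⟩, v⟩, hv⟩ := p
    obtain ⟨⟨⟨g', h'⟩, v'⟩, hv'⟩ := q
    simp only [Prod.mk.injEq, Subtype.mk.injEq] at heq fp fq
    obtain ⟨⟨h₀, h₂⟩, rfl, h₁⟩ := heq
    rw [h₀] at h₁ fp
    have h₁' := mul_left_cancel h₁
    obtain rfl : g = g' := mul_right_cancel (fp.trans fq.symm)
    congr 2
    funext i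
    fin_cases i <;> assumption

lemma eight_mul_card_commute_le (G : Type*) [Group G] [Fintype G]
    (hG : ∃ a b : G, a * b ≠ b * a) :
    8 * Nat.card {p : G × G // Commute p.1 p.2} ≤ 5 * Fintype.card G ^ 2 := by
  classical
  set n := Fintype.card G with hn
  have centralizer_le (x : G) (hx : x ∉ Subgroup.center G) :
      2 * Nat.card (Subgroup.centralizer {x}) ≤ n := by
    have hne : Subgroup.centralizer {x} ≠ ⊤ := by
      intro h
      apply hx
      rw [Subgroup.mem_center_iff]
      intro g
      have hg : g ∈ Subgroup.centralizer {x} := h ▸ Subgroup.mem_top g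
      exact Subgroup.mem_centralizer_singleton_iff.1 hg
    have hidx := Subgroup.one_lt_index_of_ne_top hne
    have := Subgroup.card_mul_index (Subgroup.centralizer {x})
    rw [Nat.card_eq_fintype_card (α := G), ← hn] at this
    nlinarith
  have center_le : 4 * Nat.card (Subgroup.center G) ≤ n := by
    obtain ⟨a, b, hab⟩ := hG
    have ha : a ∉ Subgroup.center G := fun h => hab (Subgroup.mem_center_iff.1 h b).symm
    have hle : Subgroup.center G ≤ Subgroup.centralizer {a} := Subgroup.center_le_centralizer _
    obtain ⟨k, hk⟩ := Subgroup.card_dvd_of_le hle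
    have hk₀ : k ≠ 0 := by
      rintro rfl
      exact Nat.card_pos.ne' (hk.trans (mul_zero _))
    have hk₁ : k ≠ 1 := by
      rintro rfl
      have heq := Subgroup.eq_of_le_of_card_ge hle (hk.trans (mul_one _)).le
      exact ha (heq ▸ Subgroup.mem_centralizer_singleton_iff.2 rfl)
    have hk₂ : 2 ≤ k := by omega
    have := centralizer_le a ha
    nlinarith
  have hsum : Nat.card {p : G × G // Commute p.1 p.2} =
      ∑ x : G, Nat.card (Subgroup.centralizer {x}) := by
    rw [← Nat.card_sigma]
    exact Nat.card_congr
      { toFun := fun p => ⟨p.1.1, ⟨p.1.2, Subgroup.mem_centralizer_singleton_iff.2 p.2.symm⟩⟩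
        invFun := fun q => ⟨(q.1, q.2.1),
          (Subgroup.mem_centralizer_singleton_iff.1 q.2.2).symm⟩
        left_inv := fun _ => rfl
        right_inv := fun _ => rfl }
  have hterm (x : G) : 2 * Nat.card (Subgroup.centralizer {x}) ≤
      n + if x ∈ Subgroup.center G then n else 0 := by
    split_ifs with hx
    · have := Subgroup.card_le_card_group (Subgroup.centralizer {x})
      rw [Nat.card_eq_fintype_card (α := G), ← hn] at this
      omega
    · simpa using centralizer_le x hx
  have htotal := Finset.sum_le_sum fun x (_ : x ∈ Finset.univ) => hterm x
  have hcenter : (Finset.univ.filter (· ∈ Subgroup.center G)).card =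
      Nat.card (Subgroup.center G) := by
    rw [Nat.card_eq_fintype_card, Fintype.card_subtype]
  rw [← Finset.mul_sum, ← hsum, Finset.sum_add_distrib, ← Finset.sum_filter, Finset.sum_const,
    Finset.sum_const, hcenter, Finset.card_univ, ← hn] at htotal
  simp only [smul_eq_mul] at htotal
  nlinarith

/-- for a finite nonabelian group `G` of order `n`, the number `h'(G)` of
orbits of `G³` under the `G × S₃ × G` action satisfies `48 h'(G) ≤ 5n² + 40n`. -/
theorem stmt2 (G : Type*) [Group G] [Fintype G] (hG : ∃ a b : G, a * b ≠ b * a) :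
    48 * numSkewHexagons G ≤ 5 * Fintype.card G ^ 2 + 40 * Fintype.card G := by
  have hsum := card_orbits_mul_eq_sum_card_fixedTriples G
  have hle := numSkewHexagons_le_card_orbits G
  have hcomm := eight_mul_card_commute_le G hG
  have hone := card_fixedTriples_one_le G
  have hrest : ∑ σ ∈ Finset.univ.erase (1 : Equiv.Perm (Fin 3)),
      Nat.card (FixedTriples G σ⁻¹) ≤ 5 * Fintype.card G ^ 3 := by
    refine (Finset.sum_le_card_nsmul _ _ (Fintype.card G ^ 3) fun σ hσ =>
      card_fixedTriples_le_of_ne_one G (inv_ne_one.2 (Finset.ne_of_mem_erase hσ))).trans ?_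
    simp [Fintype.card_perm, Nat.factorial]
  rw [← Finset.add_sum_erase _ _ (Finset.mem_univ 1), inv_one] at hsum
  have hn : 0 < Fintype.card G := Fintype.card_pos
  set n := Fintype.card G
  refine Nat.le_of_mul_le_mul_left ?_ (pow_pos hn 2)
  calc n ^ 2 * (48 * numSkewHexagons G)
      = 8 * (numSkewHexagons G * (6 * n ^ 2)) := by ring
    _ ≤ 8 * (n ^ 2 * Nat.card {p : G × G // Commute p.1 p.2} + 5 * n ^ 3) := by
        gcongr
        exact (Nat.mul_le_mul_right _ hle).trans (hsum.le.trans (add_le_add hone hrest))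
    _ = n ^ 2 * (8 * Nat.card {p : G × G // Commute p.1 p.2} + 40 * n) := by ring
    _ ≤ n ^ 2 * (5 * n ^ 2 + 40 * n) := by gcongr
end

section
/- Let G be a finite abelian group of order n and let x, y, z, w ∈ G. Then the number of symmetric subsets S ⊆ G³ for which there is no u ∈ G with both (x,y,u) ∈ S and (z,w,u) ∈ S is at most (3/4)^{n/23}·2^{h(G)}. -/
/-- A subset `S ⊆ G³` is symmetric if it is closed under all permutations of the three
coordinates (swap and cycle generate `S₃`) and under the diagonal left-multiplication
action of `G`. -/
def IsSymmetric {G : Type*} [CommGroup G] (S : Set (G × G × G)) : Prop :=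
  (∀ x y z : G, (x, y, z) ∈ S → (y, x, z) ∈ S) ∧
  (∀ x y z : G, (x, y, z) ∈ S → (y, z, x) ∈ S) ∧
  (∀ g x y z : G, (x, y, z) ∈ S → (g * x, g * y, g * z) ∈ S)

/-- A hexagon of an abelian group `G` is an orbit of `G³` under the combined action of
`G` (diagonal multiplication) and `S₃` (permutation of coordinates).
`hexRel v w` says that `w` lies in the orbit of `v`. -/
def hexRel {G : Type*} [CommGroup G] (v w : G × G × G) : Prop :=
  ∃ g : G, w = (g * v.1, g * v.2.1, g * v.2.2) ∨ w = (g * v.1, g * v.2.2, g * v.2.1) ∨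
    w = (g * v.2.1, g * v.1, g * v.2.2) ∨ w = (g * v.2.1, g * v.2.2, g * v.1) ∨
    w = (g * v.2.2, g * v.1, g * v.2.1) ∨ w = (g * v.2.2, g * v.2.1, g * v.1)

/-- A subset of `G³` is a hexagon if it is the orbit of some triple. -/
def IsHexagon {G : Type*} [CommGroup G] (H : Set (G × G × G)) : Prop :=
  ∃ v : G × G × G, H = {w | hexRel v w}

/-- The number of hexagons of `G`. -/
noncomputable def numHexagons (G : Type*) [CommGroup G] : ℕ :=
  Nat.card {H : Set (G × G × G) // IsHexagon H}

/-- Among the subsets of a finite set `X`, those containing none of the pairwise disjoint sets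
`P u ⊆ X` with `u ∈ A`, each of cardinality at most two, have density at most `(3/4)^|A|`. -/
theorem card_powerset_filter_not_subset_le {ι α : Type*} [DecidableEq ι] [DecidableEq α]
    (P : ι → Finset α) (hP : ∀ u, (P u).card ≤ 2) (A : Finset ι) :
    ∀ X : Finset α, (∀ u ∈ A, P u ⊆ X) →
      (∀ u ∈ A, ∀ v ∈ A, u ≠ v → Disjoint (P u) (P v)) →
      (X.powerset.filter fun T => ∀ u ∈ A, ¬ P u ⊆ T).card * 4 ^ A.card ≤
        3 ^ A.card * 2 ^ X.card := by
  induction A using Finset.induction_on with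
  | empty => intro X _ _; simp
  | insert u A hu ih =>
    intro X hX hd
    have hPX : P u ⊆ X := hX u (Finset.mem_insert_self u A)
    have hdu : ∀ v ∈ A, Disjoint (P u) (P v) := fun v hv =>
      hd u (Finset.mem_insert_self u A) v (Finset.mem_insert_of_mem hv)
        (fun h => hu (h ▸ hv))
    have ih' := ih (X \ P u)
      (fun v hv => Finset.subset_sdiff.2
        ⟨hX v (Finset.mem_insert_of_mem hv), (hdu v hv).symm⟩)
      (fun v hv w hw => hd v (Finset.mem_insert_of_mem hv) w (Finset.mem_insert_of_mem hw))
    have hle : (X.powerset.filter fun T => ∀ v ∈ insert u A, ¬ P v ⊆ T).card ≤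
        (((X \ P u).powerset.filter fun T => ∀ v ∈ A, ¬ P v ⊆ T) ×ˢ
          ((P u).powerset.erase (P u))).card := by
      refine Finset.card_le_card_of_injOn (fun T => (T \ P u, T ∩ P u)) ?_ ?_
      · intro T hT
        simp only [Finset.coe_filter, Finset.mem_powerset, Set.mem_ofPred_eq] at hT
        simp only [Finset.coe_product, Set.mem_prod, Finset.mem_coe, Finset.mem_filter,
          Finset.mem_powerset, Finset.mem_erase]
        refine ⟨⟨Finset.sdiff_subset_sdiff hT.1 le_rfl, fun v hv h => ?_⟩, fun h => ?_,
          Finset.inter_subset_right⟩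
        · exact hT.2 v (Finset.mem_insert_of_mem hv) (h.trans Finset.sdiff_subset)
        · exact hT.2 u (Finset.mem_insert_self u A) (Finset.inter_eq_right.1 h)
      · intro T _ T' _ h
        simp only [Prod.mk.injEq] at h
        rw [← Finset.sdiff_union_inter T (P u), h.1, h.2, Finset.sdiff_union_inter]
    rw [Finset.card_product, Finset.card_erase_of_mem (Finset.mem_powerset_self _),
      Finset.card_powerset] at hle
    have hcard : X.card = (X \ P u).card + (P u).card :=
      (Finset.card_sdiff_add_card_eq_card hPX).symm
    have hc : (2 ^ (P u).card - 1) * 4 ≤ 3 * 2 ^ (P u).card := by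
      have := hP u
      interval_cases (P u).card <;> norm_num
    rw [Finset.card_insert_of_notMem hu, hcard, pow_succ, pow_succ, pow_add]
    calc _ ≤ (_ * (2 ^ (P u).card - 1)) * (4 ^ A.card * 4) := Nat.mul_le_mul_right _ hle
      _ = (_ * 4 ^ A.card) * ((2 ^ (P u).card - 1) * 4) := by ring
      _ ≤ _ := Nat.mul_le_mul ih' hc
      _ = _ := by ring

/-- A reflexive symmetric relation on a finite type in which every element is related to at most
`k` elements has an independent set containing at least a `1/k` proportion of the elements. -/
theorem exists_independent_card_le_mul {ι : Type*} [Fintype ι] [DecidableEq ι]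
    (D : ι → ι → Prop) (hrefl : ∀ u, D u u) (hsymm : ∀ u v, D u v → D v u) (k : ℕ)
    (N : ι → Finset ι) (hN : ∀ u v, D u v → v ∈ N u) (hk : ∀ u, (N u).card ≤ k) :
    ∃ A : Finset ι, (∀ u ∈ A, ∀ v ∈ A, u ≠ v → ¬ D u v) ∧ Fintype.card ι ≤ A.card * k := by
  classical
  obtain ⟨A, hA⟩ := Set.Finite.exists_maximal
    (Set.toFinite {A : Finset ι | ∀ u ∈ A, ∀ v ∈ A, u ≠ v → ¬ D u v}) ⟨∅, by simp⟩
  refine ⟨A, hA.prop, ?_⟩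
  have hcover : Finset.univ ⊆ A.biUnion N := by
    intro v _
    rw [Finset.mem_biUnion]
    by_contra! hv
    have hvA : ∀ u ∈ A, ¬ D u v := fun u hu h => hv u hu (hN u v h)
    have hins : insert v A ⊆ A := hA.le_of_ge (y := insert v A) (by
      intro a ha b hb hab
      rcases Finset.mem_insert.1 ha with rfl | ha' <;>
        rcases Finset.mem_insert.1 hb with rfl | hb'
      · exact absurd rfl hab
      · exact fun h => hvA b hb' (hsymm _ _ h)
      · exact hvA a ha'
      · exact hA.prop a ha' b hb' hab) (Finset.subset_insert v A)
    exact hvA v (hins (Finset.mem_insert_self v A)) (hrefl v)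
  calc Fintype.card ι = (Finset.univ : Finset ι).card := rfl
    _ ≤ (A.biUnion N).card := Finset.card_le_card hcover
    _ ≤ A.card * k := Finset.card_biUnion_le_card_mul _ _ _ fun u _ => hk u

/-- The hexagon of a triple. -/
def hexagonOf {G : Type*} [CommGroup G] (v : G × G × G) :
    {H : Set (G × G × G) // IsHexagon H} :=
  ⟨{w | hexRel v w}, v, rfl⟩

theorem hexRel_refl {G : Type*} [CommGroup G] (v : G × G × G) : hexRel v v :=
  ⟨1, Or.inl (by simp)⟩

theorem hexRel_of_hexagonOf_eq {G : Type*} [CommGroup G] {v w : G × G × G}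
    (h : hexagonOf v = hexagonOf w) : hexRel v w := by
  have h' : {t | hexRel v t} = {t | hexRel w t} := congrArg Subtype.val h
  have hw : w ∈ {t | hexRel v t} := h' ▸ hexRel_refl w
  exact hw

theorem IsSymmetric.mem_of_hexRel {G : Type*} [CommGroup G] {S : Set (G × G × G)}
    (hS : IsSymmetric S) {v w : G × G × G} (hv : v ∈ S) (h : hexRel v w) : w ∈ S := by
  obtain ⟨h1, h2, h3⟩ := hS
  obtain ⟨a, b, c⟩ := v
  obtain ⟨g, rfl | rfl | rfl | rfl | rfl | rfl⟩ := h <;> apply h3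
  · exact hv
  · exact h1 _ _ _ (h2 _ _ _ (h2 _ _ _ hv))
  · exact h1 _ _ _ hv
  · exact h2 _ _ _ hv
  · exact h2 _ _ _ (h2 _ _ _ hv)
  · exact h1 _ _ _ (h2 _ _ _ hv)

theorem IsSymmetric.hexagonOf_subset_iff {G : Type*} [CommGroup G] {S : Set (G × G × G)}
    (hS : IsSymmetric S) {v : G × G × G} : (hexagonOf v).1 ⊆ S ↔ v ∈ S :=
  ⟨fun h => h (hexRel_refl v), fun hv _ hw => hS.mem_of_hexRel hv hw⟩

/-- The possible values of `v` for which some `(s, t, v)` lies in the hexagon of `(p, q, u)`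
through a nontrivial permutation of the coordinates. -/
def hexCompletions {G : Type*} [CommGroup G] [DecidableEq G] (s p q u : G) : Finset G :=
  {s * p⁻¹ * q, s * q⁻¹ * u, s * q⁻¹ * p, s * u⁻¹ * q, s * u⁻¹ * p}

theorem card_hexCompletions_le {G : Type*} [CommGroup G] [DecidableEq G] (s p q u : G) :
    (hexCompletions s p q u).card ≤ 5 :=
  Finset.card_le_five

theorem mem_insert_hexCompletions {G : Type*} [CommGroup G] [DecidableEq G] {s t p q u v : G}
    (h : hexRel (p, q, u) (s, t, v)) :
    v ∈ insert (s * p⁻¹ * u) (hexCompletions s p q u) := by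
  obtain ⟨g, h | h | h | h | h | h⟩ := h <;>
  · simp only [Prod.mk.injEq] at h
    obtain ⟨rfl, -, rfl⟩ := h
    simp [hexCompletions]

/-- for a finite abelian group `G` of order `n` and fixed `x y z w ∈ G`, the
number of symmetric subsets `S ⊆ G³` admitting no `u ∈ G` with `(x,y,u) ∈ S` and
`(z,w,u) ∈ S` is at most `(3/4)^{n/23} · 2^{h(G)}`. -/
theorem stmt7 (G : Type*) [CommGroup G] [Fintype G] (x y z w : G) :
    (Nat.card {S : Set (G × G × G) //
        IsSymmetric S ∧ ¬ ∃ u : G, (x, y, u) ∈ S ∧ (z, w, u) ∈ S} : ℝ) ≤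
      ((3 : ℝ) / 4) ^ ((Fintype.card G : ℝ) / 23) * 2 ^ numHexagons G := by
  classical
  let _ : Fintype {H : Set (G × G × G) // IsHexagon H} := Fintype.ofFinite _
  set P : G → Finset {H : Set (G × G × G) // IsHexagon H} :=
    fun u => {hexagonOf (x, y, u), hexagonOf (z, w, u)} with hPdef
  obtain ⟨A, hind, hA⟩ := exists_independent_card_le_mul (fun u v => ¬ Disjoint (P u) (P v))
    (fun u => by simp [hPdef]) (fun u v h h' => h h'.symm) 23
    (fun u => insert u (hexCompletions x x y u ∪ (hexCompletions z z w u ∪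
      (insert (z * x⁻¹ * u) (hexCompletions z x y u) ∪
        insert (x * z⁻¹ * u) (hexCompletions x z w u)))))
    (fun u v h => by
      simp only [hPdef, Finset.not_disjoint_iff, Finset.mem_insert, Finset.mem_singleton] at h
      obtain ⟨_, h1 | h1, h2 | h2⟩ := h <;>
      · have := mem_insert_hexCompletions (hexRel_of_hexagonOf_eq (h1.symm.trans h2))
        simp only [mul_inv_cancel, one_mul, Finset.mem_insert, Finset.mem_union] at this ⊢
        tauto)
    (fun u => by
      have h1 := card_hexCompletions_le x x y u
      have h2 := card_hexCompletions_le z z w u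
      have h3 := card_hexCompletions_le z x y u
      have h4 := card_hexCompletions_le x z w u
      refine (Finset.card_insert_le _ _).trans ?_
      have h5 := Finset.card_insert_le (z * x⁻¹ * u) (hexCompletions z x y u)
      have h6 := Finset.card_insert_le (x * z⁻¹ * u) (hexCompletions x z w u)
      have h7 := Finset.card_union_le (insert (z * x⁻¹ * u) (hexCompletions z x y u))
        (insert (x * z⁻¹ * u) (hexCompletions x z w u))
      have h8 := Finset.card_union_le (hexCompletions z z w u)
        (insert (z * x⁻¹ * u) (hexCompletions z x y u) ∪
          insert (x * z⁻¹ * u) (hexCompletions x z w u))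
      have h9 := Finset.card_union_le (hexCompletions x x y u) (hexCompletions z z w u ∪
        (insert (z * x⁻¹ * u) (hexCompletions z x y u) ∪
          insert (x * z⁻¹ * u) (hexCompletions x z w u)))
      omega)
  set F : Finset (Finset {H : Set (G × G × G) // IsHexagon H}) :=
    Finset.univ.powerset.filter fun T => ∀ u ∈ A, ¬ P u ⊆ T
  have hcount : F.card * 4 ^ A.card ≤ 3 ^ A.card * 2 ^ numHexagons G := by
    rw [numHexagons, Nat.card_eq_fintype_card, ← Finset.card_univ]
    convert card_powerset_filter_not_subset_le P (fun u => Finset.card_le_two) A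
      Finset.univ (fun u _ => Finset.subset_univ _)
      (fun u hu v hv huv => not_not.1 (hind u hu v hv huv))
  have hF : Nat.card {S : Set (G × G × G) //
      IsSymmetric S ∧ ¬ ∃ u : G, (x, y, u) ∈ S ∧ (z, w, u) ∈ S} ≤ F.card := by
    rw [← Nat.card_eq_finsetCard F]
    refine Nat.card_le_card_of_injective
      (fun S => ⟨Finset.univ.filter fun H => H.1 ⊆ S.1, ?_⟩) ?_
    · refine Finset.mem_filter.2 ⟨by simp, fun u _ h => S.2.2 ⟨u, ?_⟩⟩
      simpa [hPdef, Finset.insert_subset_iff, S.2.1.hexagonOf_subset_iff] using h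
    · intro S S' h
      ext v
      have hv := congrArg (fun T => hexagonOf v ∈ T.1) h
      simpa [S.2.1.hexagonOf_subset_iff, S'.2.1.hexagonOf_subset_iff] using hv
  have hcount' : (F.card : ℝ) * 4 ^ A.card ≤ 3 ^ A.card * 2 ^ numHexagons G := by
    exact_mod_cast hcount
  have hA' : (Fintype.card G : ℝ) / 23 ≤ A.card := by
    rw [div_le_iff₀ (by norm_num)]
    exact_mod_cast hA
  calc (Nat.card _ : ℝ) ≤ F.card := by exact_mod_cast hF
    _ ≤ ((3 : ℝ) / 4) ^ A.card * 2 ^ numHexagons G := by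
      rw [div_pow, div_mul_eq_mul_div, le_div_iff₀ (by positivity)]
      exact hcount'
    _ ≤ _ := by
      rw [← Real.rpow_natCast (3 / 4 : ℝ) A.card]
      gcongr ?_ * _
      exact Real.rpow_le_rpow_of_exponent_ge (by norm_num) (by norm_num) hA'
end
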